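/- arXiv:1910.05634 — 3 statements merged into one kernel-verified Lean document; each statement's English description precedes it below -/
import Mathlib

section
/- If C is an (n,k)_q MDS code with k > 1, then n ≤ q + k - 1. -/
/-- `C ⊆ A^n` is an `(n,k)_q` MDS code: it has `q^k` codewords and its minimum
Hamming distance equals `n - k + 1`. -/
def IsMDS {A : Type*} [DecidableEq A] {n : ℕ} (q k : ℕ) (C : Finset (Fin n → A)) : Prop :=
  C.card = q ^ k ∧
    (∀ x ∈ C, ∀ y ∈ C, x ≠ y → n - k + 1 ≤ hammingDist x y) ∧
    (∃ x ∈ C, ∃ y ∈ C, x ≠ y ∧ hammingDist x y = n - k + 1)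

/-- The Hamming weight of a word `c : Fin n → A` relative to a distinguished
zero element `z` of the alphabet: the number of coordinates different from `z`. -/
def wt {A : Type*} [DecidableEq A] {n : ℕ} (z : A) (c : Fin n → A) : ℕ :=
  (Finset.univ.filter fun i => c i ≠ z).card

/-- Two codes are equivalent if one is obtained from the other by a permutation
`σ` of the coordinate positions together with a permutation `π i` of the alphabet
applied in each position `i`. -/
def CodeEquiv {A : Type*} [DecidableEq A] {n : ℕ} (C C' : Finset (Fin n → A)) : Prop :=
  ∃ (σ : Equiv.Perm (Fin n)) (π : Fin n → Equiv.Perm A),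
    C' = C.image fun c => fun i => π i (c (σ i))

/-- Codewords of an MDS code that agree on `k` coordinates are equal. -/
theorem IsMDS.eq_of_agree {A : Type*} [DecidableEq A] {q n k : ℕ} {C : Finset (Fin n → A)}
    (hC : IsMDS q k C) {x y : Fin n → A} (hx : x ∈ C) (hy : y ∈ C) {T : Finset (Fin n)}
    (hT : T.card = k) (h : ∀ i ∈ T, x i = y i) : x = y := by
  by_contra hne
  have hdist := hC.2.1 x hx y hy hne
  have hle : hammingDist x y ≤ Tᶜ.card := by
    unfold hammingDist
    refine Finset.card_le_card fun i hi => ?_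
    simp only [Finset.mem_filter, Finset.mem_univ, true_and] at hi
    exact Finset.mem_compl.2 fun hiT => hi (h i hiT)
  rw [Finset.card_compl, Fintype.card_fin, hT] at hle
  omega

/-- Any `k` coordinates of an MDS code form an information set: the values there can be
prescribed arbitrarily. -/
theorem IsMDS.exists_agree {A : Type*} [Fintype A] [DecidableEq A] {q n k : ℕ}
    {C : Finset (Fin n → A)} (hC : IsMDS q k C) (hA : Fintype.card A = q)
    {T : Finset (Fin n)} (hT : T.card = k) (f : Fin n → A) :
    ∃ y ∈ C, ∀ i ∈ T, y i = f i := by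
  have himage : C.image (fun c (i : T) => c i) = Finset.univ := by
    apply Finset.eq_univ_of_card
    rw [Finset.card_image_of_injOn, hC.1]
    · simp [hA, hT]
    · intro x hx y hy hxy
      exact hC.eq_of_agree hx hy hT fun i hi => congrFun hxy ⟨i, hi⟩
  have hf : (fun i : T => f i) ∈ C.image (fun c (i : T) => c i) :=
    himage ▸ Finset.mem_univ _
  obtain ⟨y, hy, hyf⟩ := Finset.mem_image.1 hf
  exact ⟨y, hy, fun i hi => congrFun hyf ⟨i, hi⟩⟩

/-- an `(n,k)_q` MDS code with `k > 1` has `n ≤ q + k - 1`. -/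
theorem stmt_5 {A : Type*} [Fintype A] [DecidableEq A] {q n k : ℕ}
    (hq : 2 ≤ q) (hA : Fintype.card A = q)
    (C : Finset (Fin n → A)) (hC : IsMDS q k C) (hk : 1 < k) :
    n ≤ q + k - 1 := by
  by_contra! hn
  obtain ⟨U, hU⟩ : ∃ U : Finset (Fin n), U.card = k - 1 := by
    obtain ⟨U, -, hU⟩ := Finset.exists_subset_card_eq
      (s := (Finset.univ : Finset (Fin n))) (n := k - 1) (by simp; omega)
    exact ⟨U, hU⟩
  obtain ⟨j, hj⟩ : U.Nonempty := Finset.card_pos.1 (by omega)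
  have hUc : Uᶜ.card = n - (k - 1) := by rw [Finset.card_compl, Fintype.card_fin, hU]
  obtain ⟨m, hm⟩ : Uᶜ.Nonempty := Finset.card_pos.1 (by omega)
  have hinsert : ∀ i ∈ Uᶜ, (insert i U).card = k := fun i hi => by
    rw [Finset.card_insert_of_notMem (Finset.mem_compl.1 hi)]
    omega
  obtain ⟨x, hx, -⟩ := hC.2.2
  have : Nontrivial A := Fintype.one_lt_card_iff_nontrivial.1 (by omega)
  obtain ⟨a, ha⟩ := exists_ne (x j)
  have hline : ∀ i ∈ Uᶜ, ∃ y ∈ C, ∀ l ∈ insert i U, y l = Function.update x j a l :=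
    fun i hi => hC.exists_agree hA (hinsert i hi) _
  choose! y hyC hy using hline
  have hlt : (Finset.univ : Finset A).card < Uᶜ.card := by
    rw [Finset.card_univ, hA]
    omega
  obtain ⟨i, hi, i', hi', hne, heq⟩ := Finset.exists_ne_map_eq_of_card_lt_of_maps_to hlt
    (f := fun i => y i m) fun _ _ => Finset.mem_coe.2 (Finset.mem_univ _)
  have hyy : y i = y i' := by
    refine hC.eq_of_agree (hyC i hi) (hyC i' hi') (hinsert m hm) fun l hl => ?_
    rcases Finset.mem_insert.1 hl with rfl | hl
    · exact heq
    · rw [hy i hi l (Finset.mem_insert_of_mem hl), hy i' hi' l (Finset.mem_insert_of_mem hl)]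
  have hagree : ∀ i ∈ Uᶜ, ∀ l ∈ insert i U, l ≠ j → y i l = x l := fun i hi l hl hlj => by
    rw [hy i hi l hl, Function.update_of_ne hlj]
  have hne_j : ∀ i ∈ Uᶜ, i ≠ j := fun i hi h => Finset.mem_compl.1 hi (h ▸ hj)
  have hcard : (insert i (insert i' (U.erase j))).card = k := by
    have hiU := Finset.mem_compl.1 hi
    have hi'U := Finset.mem_compl.1 hi'
    rw [Finset.card_insert_of_notMem, Finset.card_insert_of_notMem, Finset.card_erase_of_mem hj]
    · omega
    · simp [hi'U]
    · simp [hiU, hne]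
  have hyx : y i = x := by
    refine hC.eq_of_agree (hyC i hi) hx hcard fun l hl => ?_
    rcases Finset.mem_insert.1 hl with rfl | hl
    · exact hagree l hi l (Finset.mem_insert_self _ _) (hne_j l hi)
    rcases Finset.mem_insert.1 hl with rfl | hl
    · rw [hyy]
      exact hagree l hi' l (Finset.mem_insert_self _ _) (hne_j l hi')
    · exact hagree i hi l (Finset.mem_insert_of_mem (Finset.mem_of_mem_erase hl))
        (Finset.ne_of_mem_erase hl)
  have hyj := hy i hi j (Finset.mem_insert_of_mem hj)
  rw [hyx, Function.update_self] at hyj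
  exact ha hyj.symm
end

section
/- Let C be an (n,k)_q MDS code containing the zero word 0̄, with n < q + k - 1. Then the weight spectrum of C is W(C) = {n-k+1, n-k+2, …, n}; that is, C realizes all k weights from n - k + 1 to n. -/
/-- The predicted number of codewords of an MDS code of dimension `k` that vanish on `t` given
coordinates and vanish nowhere on `s` further given coordinates. -/
def mdsCount (q k : ℕ) : ℕ → ℕ → ℤ
  | 0, t => (q : ℤ) ^ (k - t)
  | s + 1, t => mdsCount q k s t - mdsCount q k s (t + 1)

theorem mdsCount_of_add_le {q k s t : ℕ} (h : s + t ≤ k) :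
    mdsCount q k s t = ((q : ℤ) - 1) ^ s * (q : ℤ) ^ (k - (s + t)) := by
  induction s generalizing t with
  | zero => simp [mdsCount]
  | succ s ih =>
    rw [mdsCount, ih (by omega), ih (by omega)]
    obtain ⟨r, rfl⟩ := Nat.exists_eq_add_of_le h
    rw [show s + 1 + t + r - (s + t) = r + 1 by omega,
      show s + 1 + t + r - (s + (t + 1)) = r by omega,
      show s + 1 + t + r - (s + 1 + t) = r by omega]
    ring

theorem mdsCount_succ_of_le {q k s t : ℕ} (h : k ≤ t) : mdsCount q k (s + 1) t = 0 := by
  induction s generalizing t with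
  | zero => simp [mdsCount, Nat.sub_eq_zero_of_le h, Nat.sub_eq_zero_of_le (h.trans t.le_succ)]
  | succ s ih => rw [mdsCount, ih h, ih (h.trans t.le_succ), sub_zero]

theorem mdsCount_succ_pred {q k : ℕ} (s : ℕ) (hk : 1 ≤ k) :
    mdsCount q k (s + 1) (k - 1) = (q : ℤ) - 1 := by
  induction s with
  | zero => rw [mdsCount_of_add_le (by omega)]; simp [Nat.add_sub_cancel' hk]
  | succ s ih => rw [mdsCount, ih, mdsCount_succ_of_le (by omega), sub_zero]

theorem mul_mdsCount_le {q n k : ℕ} (hpos : ∀ s t, s + t ≤ n → 0 ≤ mdsCount q k s t)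
    {e s t : ℕ} (heq : e + 1 ≤ q) (hst : s + 1 + t = k + e) (hn : k + e ≤ n) (ht : t + 1 ≤ k) :
    ((q : ℤ) - 1 - e) * mdsCount q k s (t + 1) ≤ mdsCount q k (s + 1) t := by
  induction e generalizing s with
  | zero =>
    rw [mdsCount_of_add_le (by omega), mdsCount_of_add_le (by omega),
      show k - (s + (t + 1)) = 0 by omega, show k - (s + 1 + t) = 0 by omega]
    apply le_of_eq
    push_cast
    ring
  | succ e ih =>
    obtain ⟨s, rfl⟩ : ∃ r, s = r + 1 := ⟨s - 1, by omega⟩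
    have h1 := ih (s := s) (by omega) (by omega) (by omega)
    have h2 := hpos s (t + 2) (by omega)
    have h3 : mdsCount q k (s + 1) (t + 1) = mdsCount q k s (t + 1) - mdsCount q k s (t + 2) := rfl
    have h4 : mdsCount q k (s + 2) t = mdsCount q k (s + 1) t - mdsCount q k (s + 1) (t + 1) := rfl
    have h5 : (0 : ℤ) ≤ (q : ℤ) - 1 - e := by omega
    have h6 := mul_le_mul_of_nonneg_left
      (show mdsCount q k (s + 1) (t + 1) ≤ mdsCount q k s (t + 1) by linarith) h5
    push_cast
    rw [h4]
    linarith

theorem mdsCount_pos {q n k : ℕ} (hpos : ∀ s t, s + t ≤ n → 0 ≤ mdsCount q k s t)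
    (hkn : k ≤ n) (hn : n < q + k - 1) {s t : ℕ} (hst : s + t = n) (ht : t + 1 ≤ k) :
    0 < mdsCount q k s t := by
  induction s generalizing t with
  | zero => omega
  | succ s ih =>
    obtain rfl | hlt := ht.eq_or_lt
    · have := mdsCount_succ_pred (q := q) s (k := t + 1) (by omega)
      rw [Nat.add_sub_cancel] at this
      rw [this]
      omega
    · have h1 := ih (t := t + 1) (by omega) hlt
      have h2 := mul_mdsCount_le hpos (e := n - k) (s := s) (t := t)
        (by omega) (by omega) (by omega) ht
      have h3 : (1 : ℤ) ≤ (q : ℤ) - 1 - (n - k : ℕ) := by omega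
      nlinarith

section Code

variable {A : Type*} [DecidableEq A] {q n k : ℕ} {C : Finset (Fin n → A)}

/-- The codewords that equal `z` on `T` and differ from `z` everywhere on `S`. -/
def codewordsOn (C : Finset (Fin n → A)) (z : A) (S T : Finset (Fin n)) : Finset (Fin n → A) :=
  C.filter fun c => (∀ i ∈ S, c i ≠ z) ∧ ∀ i ∈ T, c i = z

theorem card_codewordsOn_insert (z : A) (S T : Finset (Fin n)) (i : Fin n) :
    (codewordsOn C z (insert i S) T).card + (codewordsOn C z S (insert i T)).card
      = (codewordsOn C z S T).card := by
  rw [← Finset.card_filter_add_card_filter_not (s := codewordsOn C z S T) fun c => c i ≠ z]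
  simp only [codewordsOn, Finset.filter_filter, Finset.forall_mem_insert]
  congr 3 <;> ext c <;> tauto

theorem IsMDS.eq_of_eqOn (hC : IsMDS q k C) (hkn : k ≤ n) {T : Finset (Fin n)} (hT : k ≤ T.card)
    {x y : Fin n → A} (hx : x ∈ C) (hy : y ∈ C) (hxy : ∀ i ∈ T, x i = y i) : x = y := by
  by_contra hne
  have h1 := hC.2.1 x hx y hy hne
  have h2 : hammingDist x y ≤ Tᶜ.card := by
    refine Finset.card_le_card fun i hi => ?_
    simp only [Finset.mem_filter, Finset.mem_univ, true_and] at hi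
    exact Finset.mem_compl.2 fun h => hi (hxy i h)
  rw [Finset.card_compl, Fintype.card_fin] at h2
  omega

theorem IsMDS.card_codewordsOn_empty [Fintype A] (hC : IsMDS q k C) (hA : Fintype.card A = q)
    (hkn : k ≤ n) {z : A} (h0 : (fun _ => z) ∈ C) (T : Finset (Fin n)) :
    (codewordsOn C z ∅ T).card = q ^ (k - T.card) := by
  obtain hT | hT := le_total k T.card
  · rw [Nat.sub_eq_zero_of_le hT, pow_zero, Finset.card_eq_one]
    refine ⟨fun _ => z, Finset.eq_singleton_iff_unique_mem.2 ⟨by simp [codewordsOn, h0], ?_⟩⟩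
    intro c hc
    simp only [codewordsOn, Finset.mem_filter] at hc
    exact hC.eq_of_eqOn hkn hT hc.1 h0 hc.2.2
  · obtain ⟨K, hTK, hK⟩ := Finset.exists_superset_card_eq hT (by simpa using hkn)
    have hinj : Set.InjOn (fun (c : Fin n → A) (i : K) => c i) C := fun x hx y hy hxy =>
      hC.eq_of_eqOn hkn hK.ge hx hy fun i hi => congrFun hxy ⟨i, hi⟩
    have himg : C.image (fun c (i : K) => c i) = Finset.univ := by
      rw [← Finset.card_eq_iff_eq_univ, Finset.card_image_of_injOn hinj, hC.1]
      simp [hA, hK]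
    have hpi : (codewordsOn C z ∅ T).image (fun c (i : K) => c i)
        = Fintype.piFinset fun i : K => if (i : Fin n) ∈ T then {z} else Finset.univ := by
      ext f
      simp only [codewordsOn, Finset.mem_image, Finset.mem_filter, Fintype.mem_piFinset]
      constructor
      · rintro ⟨c, hc, rfl⟩ i
        split_ifs with hi
        · simpa using hc.2.2 i hi
        · simp
      · intro hf
        obtain ⟨c, hc, rfl⟩ := Finset.mem_image.1 (himg ▸ Finset.mem_univ f)
        refine ⟨c, ⟨hc, by simp, fun i hi => ?_⟩, rfl⟩
        simpa [hi] using hf ⟨i, hTK hi⟩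
    rw [← Finset.card_image_of_injOn
      (hinj.mono (Finset.coe_subset.2 (Finset.filter_subset _ C)) : Set.InjOn _ ↑(codewordsOn C z ∅ T)), hpi,
      Fintype.card_piFinset]
    have hprod : ∀ i : K, (if (i : Fin n) ∈ T then {z} else Finset.univ : Finset A).card
        = if (i : Fin n) ∈ T then 1 else q := fun i => by split_ifs <;> simp [hA]
    simp only [hprod]
    rw [Finset.prod_coe_sort K (fun i => if i ∈ T then 1 else q), Finset.prod_ite]
    simp [← Finset.sdiff_eq_filter, Finset.card_sdiff_of_subset hTK, hK]

theorem IsMDS.card_codewordsOn [Fintype A] (hC : IsMDS q k C) (hA : Fintype.card A = q)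
    (hkn : k ≤ n) {z : A} (h0 : (fun _ => z) ∈ C) {S T : Finset (Fin n)} (hST : Disjoint S T) :
    ((codewordsOn C z S T).card : ℤ) = mdsCount q k S.card T.card := by
  induction S using Finset.induction_on generalizing T with
  | empty => simp [hC.card_codewordsOn_empty hA hkn h0, mdsCount]
  | insert i S hi ih =>
    rw [Finset.disjoint_insert_left] at hST
    have h1 := ih hST.2
    have h2 := ih (T := insert i T) (Finset.disjoint_insert_right.2 ⟨hi, hST.2⟩)
    rw [Finset.card_insert_of_notMem hST.1] at h2
    rw [Finset.card_insert_of_notMem hi, mdsCount, ← h1, ← h2,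
      ← card_codewordsOn_insert z S T i]
    push_cast
    ring

theorem IsMDS.mdsCount_nonneg [Fintype A] (hC : IsMDS q k C) (hA : Fintype.card A = q)
    (hkn : k ≤ n) {z : A} (h0 : (fun _ => z) ∈ C) {s t : ℕ} (hst : s + t ≤ n) :
    0 ≤ mdsCount q k s t := by
  obtain ⟨S, -, hS⟩ := Finset.exists_subset_card_eq (s := (Finset.univ : Finset (Fin n)))
    (n := s) (by simp; omega)
  obtain ⟨T, hTS, hT⟩ := Finset.exists_subset_card_eq (s := Sᶜ)
    (n := t) (by rw [Finset.card_compl, Fintype.card_fin]; omega)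
  rw [← hS, ← hT, ← hC.card_codewordsOn hA hkn h0
    (Finset.disjoint_left.2 fun i hi hi' => Finset.mem_compl.1 (hTS hi') hi)]
  positivity

end Code

/-- an `(n,k)_q` MDS code containing the zero word, with
`n < q + k - 1`, has weight spectrum `{n-k+1, n-k+2, …, n}`. -/
theorem stmt_15 {A : Type*} [Fintype A] [DecidableEq A] {q n k : ℕ}
    (hq : 2 ≤ q) (hA : Fintype.card A = q) (z : A)
    (C : Finset (Fin n → A)) (hC : IsMDS q k C)
    (h0 : (fun _ : Fin n => z) ∈ C) (hn : n < q + k - 1) :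
    {w : ℕ | ∃ c ∈ C, c ≠ (fun _ : Fin n => z) ∧ wt z c = w}
      = Set.Icc (n - k + 1) n := by
  have hk : 1 ≤ k := by
    obtain ⟨x, hx, y, hy, hxy, -⟩ := hC.2.2
    have h := Finset.one_lt_card.2 ⟨x, hx, y, hy, hxy⟩
    rw [hC.1] at h
    by_contra hk
    simp [show k = 0 by omega] at h
  have hkn : k ≤ n := by
    have h := Finset.card_le_univ C
    rw [hC.1, Fintype.card_fun, hA, Fintype.card_fin] at h
    exact (Nat.pow_le_pow_iff_right hq).1 h
  ext w
  simp only [Set.mem_ofPred_eq, Set.mem_Icc]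
  constructor
  · rintro ⟨c, hc, hne, rfl⟩
    exact ⟨hC.2.1 c hc _ h0 hne, (Finset.card_le_univ _).trans_eq (Fintype.card_fin n)⟩
  · rintro ⟨hw, hwn⟩
    obtain ⟨S, -, hS⟩ := Finset.exists_subset_card_eq (s := (Finset.univ : Finset (Fin n)))
      (n := w) (by simpa using hwn)
    have hcount := hC.card_codewordsOn hA hkn h0 (disjoint_compl_right (a := S))
    rw [Finset.card_compl, Fintype.card_fin, hS] at hcount
    have hpos := mdsCount_pos (fun s t => hC.mdsCount_nonneg hA hkn h0 (s := s) (t := t)) hkn hn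
      (s := w) (t := n - w) (by omega) (by omega)
    rw [← hcount, Nat.cast_pos, Finset.card_pos] at hpos
    obtain ⟨c, hc⟩ := hpos
    simp only [codewordsOn, Finset.mem_filter] at hc
    have hwt : wt z c = w := by
      rw [← hS, wt]
      congr 1
      ext i
      simp only [Finset.mem_filter, Finset.mem_univ, true_and]
      exact ⟨fun h => by_contra fun hi => h (hc.2.2 i (Finset.mem_compl.2 hi)), hc.2.1 i⟩
    refine ⟨c, hc.1, ?_, hwt⟩
    rintro rfl
    simp [wt] at hwt
    omega
end

section
/- Let C be an (n,k)_q MDS code containing the zero word 0̄, with k > 1. Then W(C) = {n-k+1, n-k+2, …, n} (i.e., C has precisely the k distinct nonzero weights n, n-1, …, n-k+1) if and only if n < q + k - 1. -/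
namespace IsMDS

variable {A : Type*} [DecidableEq A] {q n k : ℕ} {C : Finset (Fin n → A)}

/-- The dimension of an MDS code is at most its length. -/
theorem le_length [Fintype A] (hC : IsMDS q k C) (hq : 2 ≤ q) (hA : Fintype.card A = q) :
    k ≤ n := by
  have h := Finset.card_le_univ C
  rw [hC.1, Fintype.card_fun, hA, Fintype.card_fin] at h
  exact (Nat.pow_le_pow_iff_right hq).1 h

/-- Codewords of an MDS code that agree on `k` coordinates are equal. -/
theorem eq_of_agree_s17 (hC : IsMDS q k C) {x y : Fin n → A} (hx : x ∈ C) (hy : y ∈ C)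
    {S : Finset (Fin n)} (hS : S.card = k) (h : ∀ i ∈ S, x i = y i) : x = y := by
  by_contra hne
  have hd := hC.2.1 x hx y hy hne
  have hle : hammingDist x y ≤ Sᶜ.card := by
    refine Finset.card_le_card fun i hi => ?_
    rw [Finset.mem_compl]
    exact fun hiS => (Finset.mem_filter.1 hi).2 (h i hiS)
  rw [Finset.card_compl, Fintype.card_fin, hS] at hle
  omega

/-- Any `k` coordinates of an MDS code form an information set. -/
theorem exists_agree_s17 [Fintype A] (hC : IsMDS q k C) (hA : Fintype.card A = q)
    {S : Finset (Fin n)} (hS : S.card = k) (f : Fin n → A) :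
    ∃ x ∈ C, ∀ i ∈ S, x i = f i := by
  let r : C → (S → A) := fun x i => x.1 i.1
  have hinj : Function.Injective r := fun x y hxy =>
    Subtype.ext (hC.eq_of_agree_s17 x.2 y.2 hS fun i hi => congrFun hxy ⟨i, hi⟩)
  have hbij : Function.Bijective r := by
    rw [Fintype.bijective_iff_injective_and_card]
    refine ⟨hinj, ?_⟩
    rw [Fintype.card_coe, hC.1, Fintype.card_fun, hA, Fintype.card_coe, hS]
  obtain ⟨x, hx⟩ := hbij.2 fun i => f i.1
  exact ⟨x.1, x.2, fun i hi => congrFun hx ⟨i, hi⟩⟩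

/-- If `n - k + 1 < q`, every weight between `n - k + 1` and `n` occurs in an MDS code. -/
theorem exists_wt_eq [Fintype A] (hC : IsMDS q k C) (hq : 2 ≤ q) (hA : Fintype.card A = q)
    (hk : 1 < k) (hn : n - k + 1 < q) (z : A) {w : ℕ} (hw : n - k + 1 ≤ w) (hwn : w ≤ n) :
    ∃ c ∈ C, wt z c = w := by
  have hkn := hC.le_length hq hA
  obtain ⟨S, -, hS⟩ : ∃ S ⊆ (Finset.univ : Finset (Fin n)), S.card = k - 1 :=
    Finset.exists_subset_card_eq (by simp; omega)
  obtain ⟨T, hTS, hT⟩ : ∃ T ⊆ S, T.card = n - w :=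
    Finset.exists_subset_card_eq (by omega)
  have hSc : Sᶜ.card = n - k + 1 := by
    rw [Finset.card_compl, Fintype.card_fin, hS]; omega
  have hins : ∀ j, j ∉ S → (insert j S).card = k := fun j hj => by
    rw [Finset.card_insert_of_notMem hj, hS]; omega
  obtain ⟨j₀, hj₀⟩ : Sᶜ.Nonempty := by rw [← Finset.card_pos]; omega
  rw [Finset.mem_compl] at hj₀
  have : Nontrivial A := Fintype.one_lt_card_iff_nontrivial.1 (by omega)
  obtain ⟨a, ha⟩ := exists_ne z
  let f : Fin n → A := fun i => if i ∈ T then z else a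
  choose g hgC hg using fun b : A => hC.exists_agree_s17 hA (hins j₀ hj₀) (Function.update f j₀ b)
  have hg₀ : ∀ b, g b j₀ = b := fun b => by
    simpa using hg b j₀ (Finset.mem_insert_self _ _)
  have hgS : ∀ b, ∀ i ∈ S, g b i = f i := fun b i hi => by
    rw [hg b i (Finset.mem_insert_of_mem hi), Function.update_of_ne]
    rintro rfl
    exact hj₀ hi
  obtain ⟨b, hb⟩ : ∃ b, ∀ j ∉ S, g b j ≠ z := by
    by_contra! hcon
    choose h hhS hh using hcon
    obtain ⟨b, -, b', -, hne, hbb⟩ := Finset.exists_ne_map_eq_of_card_lt_of_maps_to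
      (s := Finset.univ) (t := Sᶜ) (f := h) (by rw [hSc, Finset.card_univ, hA]; exact hn)
      (fun b _ => by simpa using hhS b)
    have hEq : g b = g b' := by
      refine hC.eq_of_agree_s17 (hgC b) (hgC b') (hins (h b) (hhS b)) fun i hi => ?_
      rcases Finset.mem_insert.1 hi with rfl | hi
      · rw [hh b, hbb, hh b']
      · rw [hgS b i hi, hgS b' i hi]
    exact hne (by rw [← hg₀ b, hEq, hg₀ b'])
  refine ⟨g b, hgC b, ?_⟩
  have hsupp : (Finset.univ.filter fun i => g b i ≠ z) = Tᶜ := by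
    ext i
    rw [Finset.mem_filter_univ, Finset.mem_compl]
    by_cases hi : i ∈ S
    · rw [hgS b i hi]
      by_cases hiT : i ∈ T <;> simp [f, hiT, ha]
    · exact iff_of_true (hb i hi) fun hiT => hi (hTS hiT)
  rw [wt, hsupp, Finset.card_compl, Fintype.card_fin, hT]
  omega

/-- If an MDS code contains the zero word and a word of weight `n - k + 2`,
then `n - k + 1 < q`. -/
theorem lt_of_wt_eq [Fintype A] (hC : IsMDS q k C) (hq : 2 ≤ q) (hA : Fintype.card A = q)
    (hk : 1 < k) {z : A} (h0 : (fun _ : Fin n => z) ∈ C) {c : Fin n → A} (hc : c ∈ C)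
    (hw : wt z c = n - k + 2) : n - k + 1 < q := by
  have hkn := hC.le_length hq hA
  let U : Finset (Fin n) := Finset.univ.filter fun i => c i ≠ z
  have hU : U.card = n - k + 2 := hw
  have hUc : Uᶜ.card = k - 2 := by
    rw [Finset.card_compl, Fintype.card_fin, hU]; omega
  have hmem : ∀ i, i ∈ U ↔ c i ≠ z := fun i => Finset.mem_filter_univ i
  obtain ⟨i₀, hi₀⟩ : U.Nonempty := by rw [← Finset.card_pos]; omega
  have hins : ∀ i ∈ U, ∀ j ∈ U, i ≠ j → (insert j (insert i Uᶜ)).card = k := by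
    intro i hi j hj hij
    rw [Finset.card_insert_of_notMem (by simp [hj, hij.symm]),
      Finset.card_insert_of_notMem (by simp [hi]), hUc]
    omega
  let V := U.erase i₀
  have hV : V.card = n - k + 1 := by rw [Finset.card_erase_of_mem hi₀, hU]; omega
  obtain ⟨j₀, hj₀⟩ : V.Nonempty := by rw [← Finset.card_pos]; omega
  have hex : ∀ j : V, ∃ x ∈ C, x i₀ = c i₀ ∧ x j = z ∧ ∀ i ∈ Uᶜ, x i = z := by
    rintro ⟨j, hj⟩
    obtain ⟨hne, hjU⟩ := Finset.mem_erase.1 hj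
    obtain ⟨x, hxC, hx⟩ := hC.exists_agree_s17 hA (hins i₀ hi₀ j hjU hne.symm)
      (Function.update c j z)
    refine ⟨x, hxC, ?_, ?_, fun i hi => ?_⟩
    · rw [hx i₀ (by simp), Function.update_of_ne hne.symm]
    · rw [hx j (by simp), Function.update_self]
    · have hiU : i ∉ U := Finset.mem_compl.1 hi
      rw [hx i (by simp [hiU]), Function.update_of_ne (by rintro rfl; exact hiU hjU)]
      exact not_not.1 fun h => hiU ((hmem i).2 h)
  choose x hxC hxi hxj hxU using hex
  obtain ⟨hj₀ne, hj₀U⟩ := Finset.mem_erase.1 hj₀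
  have hS₀ := hins i₀ hi₀ j₀ hj₀U hj₀ne.symm
  have hinj : Function.Injective fun j : V => x j j₀ := by
    intro j j' hjj
    by_contra hne
    have hEq : x j = x j' := by
      refine hC.eq_of_agree_s17 (hxC j) (hxC j') hS₀ fun i hi => ?_
      simp only [Finset.mem_insert] at hi
      rcases hi with rfl | rfl | hi
      · exact hjj
      · rw [hxi, hxi]
      · rw [hxU j i hi, hxU j' i hi]
    have hz : x j = fun _ => z := by
      refine hC.eq_of_agree_s17 (hxC j) h0
        (hins j (Finset.mem_of_mem_erase j.2) j' (Finset.mem_of_mem_erase j'.2)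
          fun h => hne (Subtype.ext h)) fun i hi => ?_
      simp only [Finset.mem_insert] at hi
      rcases hi with rfl | rfl | hi
      · rw [hEq, hxj]
      · exact hxj j
      · exact hxU j i hi
    exact (hmem i₀).1 hi₀ (by rw [← hxi j, hz])
  have hnot : c j₀ ∉ Set.range fun j : V => x j j₀ := by
    rintro ⟨j, hj⟩
    have hEq : x j = c := by
      refine hC.eq_of_agree_s17 (hxC j) hc hS₀ fun i hi => ?_
      simp only [Finset.mem_insert] at hi
      rcases hi with rfl | rfl | hi
      · exact hj
      · exact hxi j
      · rw [hxU j i hi]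
        by_contra h
        exact Finset.mem_compl.1 hi ((hmem i).2 (Ne.symm h))
    exact (hmem j).1 (Finset.mem_of_mem_erase j.2) (by rw [← hEq, hxj])
  have hlt := Fintype.card_lt_of_injective_of_notMem _ hinj hnot
  rwa [Fintype.card_coe, hV, hA] at hlt

end IsMDS

/-- an `(n,k)_q` MDS code containing the zero word, with `k > 1`,
has weight spectrum exactly `{n-k+1, …, n}` if and only if `n < q + k - 1`. -/
theorem stmt_17 {A : Type*} [Fintype A] [DecidableEq A] {q n k : ℕ}
    (hq : 2 ≤ q) (hA : Fintype.card A = q) (z : A)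
    (C : Finset (Fin n → A)) (hC : IsMDS q k C)
    (h0 : (fun _ : Fin n => z) ∈ C) (hk : 1 < k) :
    {w : ℕ | ∃ c ∈ C, c ≠ (fun _ : Fin n => z) ∧ wt z c = w} = Set.Icc (n - k + 1) n
      ↔ n < q + k - 1 := by
  have hkn := hC.le_length hq hA
  constructor
  · intro h
    obtain ⟨c, hc, -, hw⟩ : n - k + 2 ∈ {w : ℕ | ∃ c ∈ C, c ≠ (fun _ : Fin n => z) ∧ wt z c = w} :=
      h ▸ ⟨by omega, by omega⟩
    have := hC.lt_of_wt_eq hq hA hk h0 hc hw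
    omega
  · intro h
    ext w
    constructor
    · rintro ⟨c, hc, hne, rfl⟩
      exact ⟨hC.2.1 c hc _ h0 hne, (Finset.card_le_univ _).trans_eq (Fintype.card_fin n)⟩
    · rintro ⟨hw, hwn⟩
      obtain ⟨c, hc, hcw⟩ := hC.exists_wt_eq hq hA hk (by omega) z hw hwn
      refine ⟨c, hc, ?_, hcw⟩
      rintro rfl
      simp [wt] at hcw
      omega
end
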